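/- In a multi-player perfect-information game with probabilistic transitions, countable state space, nonempty finite action sets, and bounded continuous payoff functions, for every player i ∈ N and every state s ∈ S^∞ one has lim_{k→∞} v^k_i(s) = v^∞_i(s). -/

import Mathlib

open MeasureTheory

/-- A multi-player perfect-information game with probabilistic transitions:
a set of players `N`, a state space `S` with initial state `init`, a controlling
player `ctrl s` and a nonempty finite action set `act s` for every state `s`, and
a transition probability measure `q s a` for every state `s` and action `a`.
The supports of the transition measures are mutually disjoint and every state is
reachable from the initial state, so every state is reached from `init` via
exactly one finite history (states correspond bijectively to histories). -/
structure PGame (N S A : Type*) where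
  init : S
  ctrl : S → N
  act : S → Finset A
  act_nonempty : ∀ s, (act s).Nonempty
  q : S → A → PMF S
  unique_pred : ∀ z s a s' a', a ∈ act s → a' ∈ act s' →
    z ∈ (q s a).support → z ∈ (q s' a').support → s = s' ∧ a = a'
  init_not_succ : ∀ s a, a ∈ act s → init ∉ (q s a).support
  reach : ∀ z, Relation.ReflTransGen (fun s t => ∃ a ∈ act s, t ∈ (q s a).support) init z

namespace PGame

variable {N S A : Type*} (G : PGame N S A)

/-- A play: an infinite alternating sequence of states and actions, starting at the
initial state, choosing legal actions and moving to successor states. -/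
def IsPlay (p : ℕ → S × A) : Prop :=
  (p 0).1 = G.init ∧
    ∀ m, (p m).2 ∈ G.act (p m).1 ∧ (p (m + 1)).1 ∈ (G.q (p m).1 (p m).2).support

/-- The set of plays of the game. -/
def Play : Type _ := { p : ℕ → S × A // G.IsPlay p }

/-- The set of plays carries the topology generated by the cylinder sets, i.e. the
topology induced by the product of the discrete topologies. -/
instance : TopologicalSpace G.Play :=
  letI : TopologicalSpace S := ⊥
  letI : TopologicalSpace A := ⊥
  inferInstanceAs (TopologicalSpace { p : ℕ → S × A // G.IsPlay p })

/-- The Borel σ-algebra on plays. -/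
instance : MeasurableSpace G.Play := borel G.Play

/-- A strategy of player `i`: a choice of a legal action in every state controlled
by `i`. -/
def Strat (i : N) : Type _ := { f : S → A // ∀ s, G.ctrl s = i → f s ∈ G.act s }

/-- A strategy profile. -/
def Profile : Type _ := ∀ i : N, G.Strat i

/-- The profile `σ` with player `i`'s strategy replaced by `τi`. -/
noncomputable def comb (i : N) (τi : G.Strat i) (σ : G.Profile) : G.Profile :=
  haveI := Classical.decEq N
  Function.update σ i τi

/-- The action that profile `σ` plays in state `s`. -/
def playFun (σ : G.Profile) (s : S) : A := (σ (G.ctrl s)).1 s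

/-- The cylinder set of plays agreeing with the play `p0` on the first `n`
coordinates. -/
def cylSet (p0 : G.Play) (n : ℕ) : Set G.Play := { p : G.Play | ∀ m < n, p.1 m = p0.1 m }

open Classical in
/-- `μ` is the family of Borel probability measures on plays induced by the strategy
profiles via the Ionescu–Tulcea construction applied to `q`; it is uniquely
characterized by the probabilities it assigns to the cylinder sets: actions are
chosen deterministically according to the profile and states are drawn from the
transition probabilities. -/
def IsInducedMeasure (μ : G.Profile → Measure G.Play) : Prop :=
  (∀ σ, IsProbabilityMeasure (μ σ)) ∧
    ∀ (σ : G.Profile) (p0 : G.Play) (n : ℕ),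
      μ σ (G.cylSet p0 n) =
        ∏ m ∈ Finset.range n,
          ((if (p0.1 m).2 = G.playFun σ (p0.1 m).1 then 1 else 0) *
            (if m + 1 < n then G.q (p0.1 m).1 (p0.1 m).2 ((p0.1 (m + 1)).1) else 1))

/-- Expected payoff of player `i` under the profile `σ`: the integral of `u i`
against the induced measure. -/
noncomputable def epay (μ : G.Profile → Measure G.Play) (u : N → G.Play → ℝ)
    (σ : G.Profile) (i : N) : ℝ :=
  ∫ p, u i p ∂(μ σ)

/-- Nash equilibrium: no player can improve his expected payoff by a unilateral
deviation. -/
def IsNash (μ : G.Profile → Measure G.Play) (u : N → G.Play → ℝ) (σ : G.Profile) : Prop :=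
  ∀ (i : N) (τi : G.Strat i), G.epay μ u (G.comb i τi σ) i ≤ G.epay μ u σ i

/-- Secure equilibrium: a Nash equilibrium such that no player `i` has a deviation
keeping his own expected payoff equal, making all opponents weakly worse off, and
making some opponent strictly worse off. -/
def IsSecure (μ : G.Profile → Measure G.Play) (u : N → G.Play → ℝ) (σ : G.Profile) : Prop :=
  G.IsNash μ u σ ∧
    ¬ ∃ (i : N) (τi : G.Strat i),
        G.epay μ u (G.comb i τi σ) i = G.epay μ u σ i ∧
        (∀ j : N, j ≠ i → G.epay μ u (G.comb i τi σ) j ≤ G.epay μ u σ j) ∧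
        (∃ k : N, k ≠ i ∧ G.epay μ u (G.comb i τi σ) k < G.epay μ u σ k)

/-- One-step successor relation between states. -/
def step (s t : S) : Prop := ∃ a ∈ G.act s, t ∈ (G.q s a).support

/-- The set of plays that pass through the state `s` (i.e. the plays extending the
unique history from the initial state to `s`). -/
def through (s : S) : Set G.Play := { p : G.Play | ∃ n, (p.1 n).1 = s }

/-- `E` is the family of subgame expected payoffs: `E σ s i` is the expected payoff
`u_i(σ|s)` of player `i` in the subgame `G(s)` starting from state `s`, under the
profile `σ`.  It is characterized as follows: `E σ s i` only depends on the actions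
of `σ` in the subtree rooted at `s`, and for any profile `τ` agreeing with `σ`
there, the integral of `u_i` over the set of plays through `s` under the measure
induced by `τ` equals `E σ s i` times the probability of reaching `s` under `τ`. -/
def IsSubgamePayoff (μ : G.Profile → Measure G.Play) (u : N → G.Play → ℝ)
    (E : G.Profile → S → N → ℝ) : Prop :=
  ∀ (σ τ : G.Profile) (s : S) (i : N),
    (∀ z, Relation.ReflTransGen G.step s z → G.playFun τ z = G.playFun σ z) →
    ∫ p in G.through s, u i p ∂(μ τ) = E σ s i * (μ τ (G.through s)).toReal
/-- One-step successor relation using only actions in the restricted action sets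
`B`. -/
def stepIn (B : S → Set A) (s t : S) : Prop := ∃ a ∈ B s, t ∈ (G.q s a).support

/-- The value `v_i(s)` for player `i` of the zero-sum subgame from `s` of the game
restricted to the action sets `B`: player `i` maximizes the expectation of `u_i`
over his strategies playing in `B` (on the states reachable from `s` via
`B`-actions), while the coalition of his opponents jointly minimizes it over their
strategies playing in `B` there. -/
noncomputable def rval (E : G.Profile → S → N → ℝ) (B : S → Set A) (s : S) (i : N) : ℝ :=
  ⨆ τi : { f : G.Strat i //
      ∀ z, Relation.ReflTransGen (G.stepIn B) s z → G.ctrl z = i → f.1 z ∈ B z },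
    ⨅ τo : { g : G.Profile //
      ∀ z, Relation.ReflTransGen (G.stepIn B) s z → G.ctrl z ≠ i → G.playFun g z ∈ B z },
      E (G.comb i τi.1 τo.1) s i

/-- `v_i(s,a) = ∑_{z ∈ S(s,a)} q(s,a)(z) · v_i(z)` in the game restricted to the
action sets `B`. -/
noncomputable def rvalQ (E : G.Profile → S → N → ℝ) (B : S → Set A)
    (s : S) (a : A) (i : N) : ℝ :=
  ∑' z : S, ((G.q s a) z).toReal * G.rval E B z i

/-- The elimination procedure: `Ak E 0 = A`, and `Ak E (k+1) s` consists of the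
actions of `Ak E k s` that are optimal for the controlling player in the game
`G^k` restricted to the action sets `Ak E k`, i.e. such that
`v^k_{i(s)}(s,a) = v^k_{i(s)}(s)`. -/
noncomputable def Ak (E : G.Profile → S → N → ℝ) (k : ℕ) : S → Set A :=
  Nat.rec (motive := fun _ => S → Set A)
    (fun s => (G.act s : Set A))
    (fun _ B s =>
      { a ∈ B s | G.rvalQ E B s a (G.ctrl s) = G.rval E B s (G.ctrl s) })
    k

/-- `Sk E k` is the state space `S^k` of the game `G^k`: the set of states
reachable from the initial state using only actions in the sets `Ak E k`. -/
def Sk (E : G.Profile → S → N → ℝ) (k : ℕ) : Set S :=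
  { z | Relation.ReflTransGen (G.stepIn (G.Ak E k)) G.init z }

/-- `S^∞ = ⋂_k S^k`. -/
def Sinf (E : G.Profile → S → N → ℝ) : Set S := ⋂ k, G.Sk E k

/-- `A^∞(s) = ⋂_k A^k(s)`. -/
def Ainf (E : G.Profile → S → N → ℝ) (s : S) : Set A := ⋂ k, G.Ak E k s
end PGame

namespace PGame

section Aux

open Relation Filter Topology

variable {N S A : Type*} (G : PGame N S A)

/-- A legal choice of an action in every state. -/
def Sel : Type _ := ∀ s, {a : A // a ∈ G.act s}

/-- The profile associated with a selection. -/
def prof (f : G.Sel) : G.Profile := fun _ => ⟨fun s => (f s).1, fun s _ => (f s).2⟩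

theorem playFun_prof (f : G.Sel) (s : S) : G.playFun (G.prof f) s = (f s).1 := rfl

theorem playFun_mem (σ : G.Profile) (s : S) : G.playFun σ s ∈ G.act s :=
  (σ (G.ctrl s)).2 s rfl

/-- One-step relation following the selection. -/
def stepS (f : G.Sel) (s t : S) : Prop := t ∈ (G.q s (f s).1).support

theorem stepS_step {f : G.Sel} {s t : S} (h : G.stepS f s t) : G.step s t :=
  ⟨_, (f s).2, h⟩

theorem no_loop (s : S) : ¬ TransGen G.step s s := by
  have h : ReflTransGen G.step G.init s := G.reach s
  induction h with
  | refl =>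
    intro h
    obtain ⟨b, _, a, ha, hb⟩ := TransGen.tail'_iff.1 h
    exact G.init_not_succ b a ha hb
  | tail _ hbc ih =>
    rename_i b c _
    intro h
    obtain ⟨d, hd, a, ha, hc⟩ := TransGen.tail'_iff.1 h
    obtain ⟨a', ha', hc'⟩ := hbc
    obtain ⟨rfl, rfl⟩ := G.unique_pred _ _ _ _ _ ha ha' hc hc'
    exact ih (TransGen.head' ⟨_, ha, hc⟩ hd)

theorem reach_succ {s w z : S} (hwz : G.step w z) (h : ReflTransGen G.step s z) :
    z = s ∨ ReflTransGen G.step s w := by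
  rcases ReflTransGen.cases_tail h with h | ⟨d, hd, a, ha, hz⟩
  · exact Or.inl h
  · obtain ⟨a', ha', hz'⟩ := hwz
    obtain ⟨rfl, rfl⟩ := G.unique_pred _ _ _ _ _ ha ha' hz hz'
    exact Or.inr hd

theorem unique_branch {s z z' w : S} {a : A} (ha : a ∈ G.act s) (hz : z ∈ (G.q s a).support)
    (hz' : z' ∈ (G.q s a).support) (h : ReflTransGen G.step z w)
    (h' : ReflTransGen G.step z' w) : z = z' := by
  have key : ∀ x ∈ (G.q s a).support, ¬ ReflTransGen G.step x s := fun x hx hr =>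
    G.no_loop s (TransGen.head' ⟨a, ha, hx⟩ hr)
  induction h with
  | refl =>
    rcases G.reach_succ ⟨a, ha, hz⟩ h' with h | h
    · exact h
    · exact absurd h (key _ hz')
  | tail h1 hbc ih =>
    rcases G.reach_succ hbc h' with h | h
    · subst h
      obtain ⟨a', ha', hc'⟩ := hbc
      obtain ⟨rfl, rfl⟩ := G.unique_pred _ _ _ _ _ ha ha' hz' hc'
      exact absurd h1 (key _ hz)
    · exact ih h

open Classical in
/-- Use `f` below `s` and `r` elsewhere. -/
noncomputable def redir (s : S) (r f : G.Sel) : G.Sel :=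
  fun z => if ReflTransGen G.step s z then f z else r z

theorem redir_below {s z : S} (r f : G.Sel) (h : ReflTransGen G.step s z) :
    G.redir s r f z = f z := if_pos h

theorem redir_reach {s : S} {r : G.Sel} (f : G.Sel) (h : ReflTransGen (G.stepS r) G.init s) :
    ReflTransGen (G.stepS (G.redir s r f)) G.init s := by
  have : ∀ w, ReflTransGen (G.stepS r) G.init w → ReflTransGen G.step w s →
      ReflTransGen (G.stepS (G.redir s r f)) G.init w := by
    intro w hw
    induction hw with
    | refl => intro _; exact ReflTransGen.refl
    | tail h1 hbc ih =>
      rename_i b c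
      intro hc
      refine (ih (ReflTransGen.head (G.stepS_step hbc) hc)).tail ?_
      have hb : ¬ ReflTransGen G.step s b := fun hb =>
        G.no_loop b (TransGen.head' (G.stepS_step hbc) (hc.trans hb))
      have e : G.redir s r f b = r b := if_neg hb
      unfold stepS
      rw [e]
      exact hbc
  exact this s h ReflTransGen.refl

theorem exists_sel : Nonempty G.Sel :=
  ⟨fun s => ⟨(G.act_nonempty s).choose, (G.act_nonempty s).choose_spec⟩⟩

theorem exists_reach (s : S) : ∃ r : G.Sel, ReflTransGen (G.stepS r) G.init s := by
  have h : ReflTransGen G.step G.init s := G.reach s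
  induction h with
  | refl => exact ⟨G.exists_sel.some, ReflTransGen.refl⟩
  | tail _ hbc ih =>
    rename_i b c _
    obtain ⟨r, hr⟩ := ih
    obtain ⟨a, ha, hc⟩ := hbc
    classical
    let f : G.Sel := Function.update r b ⟨a, ha⟩
    refine ⟨G.redir b r f, (G.redir_reach f hr).tail ?_⟩
    unfold stepS
    rw [G.redir_below r f ReflTransGen.refl]
    have : f b = ⟨a, ha⟩ := Function.update_self ..
    rw [this]; exact hc

/-- A selection reaching `s`. -/
noncomputable def toward (s : S) : G.Sel := (G.exists_reach s).choose

theorem toward_reach (s : S) : ReflTransGen (G.stepS (G.toward s)) G.init s :=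
  (G.exists_reach s).choose_spec

/-- Redirection towards `s`, then `f`. -/
noncomputable def rd (s : S) (f : G.Sel) : G.Sel := G.redir s (G.toward s) f

theorem rd_reach (s : S) (f : G.Sel) : ReflTransGen (G.stepS (G.rd s f)) G.init s :=
  G.redir_reach f (G.toward_reach s)

theorem rd_below {s z : S} (f : G.Sel) (h : ReflTransGen G.step s z) :
    G.rd s f z = f z := if_pos h

theorem rd_not_below {s z : S} (f : G.Sel) (h : ¬ ReflTransGen G.step s z) :
    G.rd s f z = G.toward s z := if_neg h

/-- States reached under `rd s f` below `s` are reached from `s` under `f`. -/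
theorem rd_reach_below {s : S} (f : G.Sel) {w : S}
    (hw : ReflTransGen (G.stepS (G.rd s f)) G.init w) (h : ReflTransGen G.step s w) :
    ReflTransGen (G.stepS f) s w := by
  induction hw with
  | refl =>
    rcases ReflTransGen.cases_tail h with h | ⟨d, hd, a, ha, hz⟩
    · rw [h]
    · exact absurd hz (G.init_not_succ _ _ ha)
  | tail h1 hbc ih =>
    rename_i b c
    rcases G.reach_succ (G.stepS_step hbc) h with h | h
    · rw [h]
    · refine (ih h).tail ?_
      unfold stepS at hbc ⊢
      rwa [G.rd_below f h] at hbc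

/-! ### Plays -/

theorem play_unique (p p' : G.Play) (n n' : ℕ) (h : (p.1 n).1 = (p'.1 n').1) :
    n = n' ∧ ∀ m < n, p.1 m = p'.1 m := by
  induction n generalizing n' with
  | zero =>
    cases n' with
    | zero => simp
    | succ k =>
      rw [p.2.1] at h
      exact absurd (h ▸ (p'.2.2 k).2) (G.init_not_succ _ _ (p'.2.2 k).1)
  | succ n ih =>
    cases n' with
    | zero =>
      rw [p'.2.1] at h
      exact absurd (h ▸ (p.2.2 n).2) (G.init_not_succ _ _ (p.2.2 n).1)
    | succ k =>
      obtain ⟨h1, h2⟩ := G.unique_pred _ _ _ _ _ (p.2.2 n).1 (p'.2.2 k).1 (p.2.2 n).2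
        (h ▸ (p'.2.2 k).2)
      obtain ⟨rfl, h3⟩ := ih k h1
      refine ⟨rfl, fun m hm => ?_⟩
      rcases Nat.lt_succ_iff_lt_or_eq.1 hm with hm | rfl
      · exact h3 m hm
      · exact Prod.ext h1 h2

/-- The play follows the selection. -/
def Follows (f : G.Sel) (p : G.Play) : Prop := ∀ m, (p.1 m).2 = (f (p.1 m).1).1

theorem exists_seq (f : G.Sel) {z s : S} (h : ReflTransGen (G.stepS f) z s) :
    ∃ x : ℕ → S, x 0 = z ∧ (∀ m, G.stepS f (x m) (x (m + 1))) ∧ ∃ n, x n = s := by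
  induction h using ReflTransGen.head_induction_on with
  | refl =>
    have : ∀ t, ∃ t', G.stepS f t t' := fun t => (G.q t (f t).1).support_nonempty
    choose g hg using this
    refine ⟨fun n => g^[n] s, rfl, fun m => ?_, 0, rfl⟩
    change G.stepS f (g^[m] s) (g^[m + 1] s)
    rw [Function.iterate_succ_apply']
    exact hg _
  | head h1 h2 ih =>
    rename_i a c
    obtain ⟨x, hx0, hx, n, hn⟩ := ih
    refine ⟨fun m => Nat.casesOn m a x, rfl, fun m => ?_, n + 1, hn⟩
    cases m with
    | zero => simpa [hx0] using h1
    | succ m => exact hx m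

theorem exists_play (f : G.Sel) {s : S} (h : ReflTransGen (G.stepS f) G.init s) :
    ∃ p : G.Play, G.Follows f p ∧ ∃ n, (p.1 n).1 = s := by
  obtain ⟨x, hx0, hx, n, hn⟩ := G.exists_seq f h
  exact ⟨⟨fun m => (x m, (f (x m)).1), hx0, fun m => ⟨(f (x m)).2, hx m⟩⟩, fun m => rfl, n, hn⟩

end Aux

end PGame

namespace PGame

section Aux2

open Relation Filter Topology MeasureTheory

variable {N S A : Type*} (G : PGame N S A)

instance : BorelSpace G.Play := ⟨rfl⟩

theorem isOpen_coord (n : ℕ) (P : S × A → Prop) : IsOpen {p : G.Play | P (p.1 n)} := by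
  let : TopologicalSpace S := ⊥
  let : TopologicalSpace A := ⊥
  have : DiscreteTopology S := ⟨rfl⟩
  have : DiscreteTopology A := ⟨rfl⟩
  have hc : Continuous (fun p : {p : ℕ → S × A // G.IsPlay p} => p.1 n) :=
    (continuous_apply n).comp continuous_subtype_val
  exact (isOpen_discrete {x | P x}).preimage hc

theorem isOpen_cylSet (p0 : G.Play) (n : ℕ) : IsOpen (G.cylSet p0 n) := by
  have : G.cylSet p0 n = ⋂ m ∈ Finset.range n, {p : G.Play | p.1 m = p0.1 m} := by
    ext p; simp [cylSet]
  rw [this]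
  exact isOpen_biInter_finset fun m _ => G.isOpen_coord m (fun x => x = p0.1 m)

theorem exists_cylSet_subset {U : Set G.Play} (hU : IsOpen U) {p : G.Play} (hp : p ∈ U) :
    ∃ n, G.cylSet p n ⊆ U := by
  let : TopologicalSpace S := ⊥
  let : TopologicalSpace A := ⊥
  have hU' : @IsOpen {p : ℕ → S × A // G.IsPlay p} _ U := hU
  obtain ⟨V, hV, rfl⟩ := isOpen_induced_iff.1 hU'
  obtain ⟨I, w, hw, hsub⟩ := isOpen_pi_iff.1 hV p.1 hp
  refine ⟨I.sup id + 1, fun p' hp' => hsub fun m hm => ?_⟩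
  have := hp' m (Nat.lt_succ_of_le (Finset.le_sup (f := id) hm))
  rw [this]
  exact (hw m hm).2

theorem isOpen_through (s : S) : IsOpen (G.through s) := by
  have : G.through s = ⋃ n, {p : G.Play | (p.1 n).1 = s} := by
    ext p; simp [through]
  rw [this]
  exact isOpen_iUnion fun n => G.isOpen_coord n (fun x => x.1 = s)

theorem isClosed_through (s : S) : IsClosed (G.through s) := by
  obtain ⟨p0, -, n, hn⟩ := G.exists_play _ (G.toward_reach s)
  have : G.through s = {p : G.Play | (p.1 n).1 = s} := by
    ext p
    refine ⟨?_, fun h => ⟨n, h⟩⟩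
    rintro ⟨m, hm⟩
    obtain ⟨rfl, -⟩ := G.play_unique p p0 m n (hm.trans hn.symm)
    exact hm
  rw [this, ← isOpen_compl_iff]
  exact G.isOpen_coord n (fun x => ¬ x.1 = s)

/-- Part of an open set. -/
def piece (U : Set G.Play) (n : ℕ) (x : S × A) : Set G.Play :=
  {p | p.1 n = x ∧ G.cylSet p (n + 1) ⊆ U}

theorem cylSet_eq_of_coord {p p0 : G.Play} {n : ℕ} (h : p.1 n = p0.1 n) :
    p ∈ G.cylSet p0 (n + 1) := by
  intro m hm
  rcases Nat.lt_succ_iff_lt_or_eq.1 hm with hm | rfl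
  · exact (G.play_unique p p0 n n (by rw [h])).2 m hm
  · exact h

theorem cylSet_congr {p p0 : G.Play} {n : ℕ} (h : p ∈ G.cylSet p0 n) :
    G.cylSet p n = G.cylSet p0 n := by
  ext p'
  exact ⟨fun h' m hm => (h' m hm).trans (h m hm), fun h' m hm => (h' m hm).trans (h m hm).symm⟩

theorem piece_eq (U : Set G.Play) (n : ℕ) (x : S × A) :
    G.piece U n x = ∅ ∨ ∃ p0, G.piece U n x = G.cylSet p0 (n + 1) := by
  rcases (G.piece U n x).eq_empty_or_nonempty with h | ⟨p0, h1, h2⟩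
  · exact Or.inl h
  · refine Or.inr ⟨p0, ?_⟩
    ext p
    constructor
    · rintro ⟨h3, h4⟩
      exact G.cylSet_eq_of_coord (h3.trans h1.symm)
    · intro h
      exact ⟨(h n (Nat.lt_succ_self n)).trans h1, by rwa [G.cylSet_congr h]⟩

theorem isOpen_piece (U : Set G.Play) (n : ℕ) (x : S × A) : IsOpen (G.piece U n x) := by
  rcases G.piece_eq U n x with h | ⟨p0, h⟩ <;> rw [h]
  · exact isOpen_empty
  · exact G.isOpen_cylSet _ _

/-- Index set of cylinders. -/
abbrev Idx : Type _ := Σ s, {a : A // a ∈ G.act s}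

theorem measure_open [Countable S] (ν : Measure G.Play) {U : Set G.Play} (hU : IsOpen U) :
    ν U = ⨆ n, ∑' x : G.Idx, ν (G.piece U n (x.1, x.2.1)) := by
  have h1 : ∀ n, ∑' x : G.Idx, ν (G.piece U n (x.1, x.2.1)) =
      ν (⋃ x : G.Idx, G.piece U n (x.1, x.2.1)) := by
    intro n
    rw [measure_iUnion]
    · intro x y hxy
      rw [Function.onFun, Set.disjoint_left]
      rintro p ⟨h, -⟩ ⟨h', -⟩
      apply hxy
      have h'' := h.symm.trans h'
      obtain ⟨s, a, ha⟩ := x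
      obtain ⟨s', a', ha'⟩ := y
      simp only [Prod.mk.injEq] at h''
      obtain ⟨rfl, rfl⟩ := h''
      rfl
    · exact fun x => (G.isOpen_piece _ _ _).measurableSet
  have h2 : ∀ n, (⋃ x : G.Idx, G.piece U n (x.1, x.2.1)) =
      {p | G.cylSet p (n + 1) ⊆ U} := by
    intro n
    ext p
    simp only [Set.mem_iUnion, piece, Set.mem_ofPred_eq]
    refine ⟨fun ⟨_, _, h⟩ => h, fun h => ⟨⟨(p.1 n).1, (p.1 n).2, (p.2.2 n).1⟩, rfl, h⟩⟩
  simp_rw [h1, h2]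
  rw [← Monotone.measure_iUnion]
  · congr 1
    ext p
    simp only [Set.mem_iUnion, Set.mem_ofPred_eq]
    constructor
    · intro hp
      obtain ⟨n, hn⟩ := G.exists_cylSet_subset hU hp
      exact ⟨n, fun p' hp' => hn fun m hm => hp' m (by omega)⟩
    · rintro ⟨n, hn⟩
      exact hn fun m _ => rfl
  · intro n n' hnn p hp p' hp'
    exact hp fun m hm => hp' m (by omega)

variable {G} {μ : G.Profile → Measure G.Play}

theorem measure_cyl_congr (hμ : G.IsInducedMeasure μ) (f g : G.Sel) (p0 : G.Play) (n : ℕ)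
    (h : ∀ m < n, f (p0.1 m).1 = g (p0.1 m).1) :
    μ (G.prof f) (G.cylSet p0 n) = μ (G.prof g) (G.cylSet p0 n) := by
  rw [hμ.2, hμ.2]
  refine Finset.prod_congr rfl fun m hm => ?_
  rw [playFun_prof, playFun_prof, h m (Finset.mem_range.1 hm)]

theorem measure_cyl_zero (hμ : G.IsInducedMeasure μ) (f : G.Sel) (p0 : G.Play) (n : ℕ)
    {m : ℕ} (hm : m < n) (h : (p0.1 m).2 ≠ (f (p0.1 m).1).1) :
    μ (G.prof f) (G.cylSet p0 n) = 0 := by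
  rw [hμ.2]
  refine Finset.prod_eq_zero (Finset.mem_range.2 hm) ?_
  rw [playFun_prof, if_neg h, zero_mul]

theorem measure_cyl_follows (hμ : G.IsInducedMeasure μ) (f : G.Sel) (p0 : G.Play) (n : ℕ)
    (h : G.Follows f p0) :
    μ (G.prof f) (G.cylSet p0 (n + 1)) =
      ∏ m ∈ Finset.range n, G.q (p0.1 m).1 (p0.1 m).2 (p0.1 (m + 1)).1 := by
  rw [hμ.2, Finset.prod_range_succ]
  rw [if_neg (by simp : ¬ n + 1 < n + 1), playFun_prof, if_pos (h n), one_mul, mul_one]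
  refine Finset.prod_congr rfl fun m hm => ?_
  rw [playFun_prof, if_pos (h m), one_mul, if_pos]
  have := Finset.mem_range.1 hm
  omega

theorem ae_follows [Countable S] (hμ : G.IsInducedMeasure μ) (f : G.Sel) :
    ∀ᵐ p ∂(μ (G.prof f)), G.Follows f p := by
  unfold Follows
  rw [ae_all_iff]
  intro n
  have : ∀ x : G.Idx, x.2.1 ≠ (f x.1).1 → ∀ᵐ p ∂(μ (G.prof f)), p.1 n ≠ (x.1, x.2.1) := by
    intro x hx
    rw [ae_iff]
    simp only [ne_eq, not_not]
    by_cases hne : ∃ p0 : G.Play, p0.1 n = (x.1, x.2.1)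
    · obtain ⟨p0, hp0⟩ := hne
      refine measure_mono_null (fun p hp => ?_) (measure_cyl_zero hμ f p0 (n + 1)
        (Nat.lt_succ_self n) (by rw [hp0]; exact hx))
      exact G.cylSet_eq_of_coord (Eq.trans hp hp0.symm)
    · push Not at hne
      have : {p : G.Play | p.1 n = (x.1, x.2.1)} = ∅ := by
        ext p; simpa using hne p
      rw [this, measure_empty]
  have h2 : ∀ᵐ p ∂(μ (G.prof f)), ∀ x : G.Idx, x.2.1 ≠ (f x.1).1 → p.1 n ≠ (x.1, x.2.1) := by
    rw [ae_all_iff]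
    intro x
    by_cases hx : x.2.1 ≠ (f x.1).1
    · filter_upwards [this x hx] with p hp _ using hp
    · exact Eventually.of_forall fun p h => absurd h hx
  filter_upwards [h2] with p hp
  by_contra hne
  exact hp ⟨(p.1 n).1, (p.1 n).2, (p.2.2 n).1⟩ hne rfl

theorem measure_through [Countable S] (hμ : G.IsInducedMeasure μ) (f : G.Sel) (p0 : G.Play)
    (n : ℕ) (h : G.Follows f p0) :
    μ (G.prof f) (G.through (p0.1 n).1) =
      ∏ m ∈ Finset.range n, G.q (p0.1 m).1 (p0.1 m).2 (p0.1 (m + 1)).1 := by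
  rw [← measure_cyl_follows hμ f p0 n h]
  apply measure_congr
  filter_upwards [ae_follows hμ f] with p hp
  apply propext
  constructor
  · rintro ⟨m, hm⟩
    obtain ⟨rfl, -⟩ := G.play_unique p p0 m n hm
    refine G.cylSet_eq_of_coord (Prod.ext hm ?_)
    rw [hp, h, hm]
  · intro hc
    exact ⟨n, by rw [hc n (Nat.lt_succ_self n)]⟩

theorem measure_through_ne_zero [Countable S] (hμ : G.IsInducedMeasure μ) (f : G.Sel) {s : S}
    (h : ReflTransGen (G.stepS f) G.init s) : μ (G.prof f) (G.through s) ≠ 0 := by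
  obtain ⟨p0, hp0, n, rfl⟩ := G.exists_play f h
  rw [measure_through hμ f p0 n hp0, Finset.prod_ne_zero_iff]
  intro m _
  exact (PMF.mem_support_iff _ _).1 (p0.2.2 m).2

theorem measure_congr_reach [Countable S] (hμ : G.IsInducedMeasure μ) (f g : G.Sel)
    (h : ∀ z, ReflTransGen (G.stepS f) G.init z → f z = g z) :
    μ (G.prof f) = μ (G.prof g) := by
  have hcyl : ∀ (p0 : G.Play) (n : ℕ),
      μ (G.prof f) (G.cylSet p0 n) = μ (G.prof g) (G.cylSet p0 n) := by
    intro p0 n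
    by_cases hall : ∀ m < n, f (p0.1 m).1 = g (p0.1 m).1
    · exact measure_cyl_congr hμ f g p0 n hall
    · push Not at hall
      classical
      obtain ⟨hm, hne⟩ := Nat.find_spec hall
      set k := Nat.find hall with hk
      have hmin : ∀ m < k, f (p0.1 m).1 = g (p0.1 m).1 := by
        intro m hmk
        by_contra hc
        exact Nat.find_min hall hmk ⟨hmk.trans hm, hc⟩
      have hex : ∃ m < k, (p0.1 m).2 ≠ (f (p0.1 m).1).1 := by
        by_contra hcon
        push Not at hcon
        have hr : ∀ m ≤ k, ReflTransGen (G.stepS f) G.init (p0.1 m).1 := by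
          intro m
          induction m with
          | zero => intro _; rw [p0.2.1]
          | succ m ih =>
            intro hmk
            refine (ih (by omega)).tail ?_
            unfold stepS
            rw [← hcon m (by omega)]
            exact (p0.2.2 m).2
        exact hne (h _ (hr k le_rfl))
      obtain ⟨m, hmk, hmf⟩ := hex
      rw [measure_cyl_zero hμ f p0 n (hmk.trans hm) hmf,
        measure_cyl_zero hμ g p0 n (hmk.trans hm) (by rw [← hmin m hmk]; exact hmf)]
  have := hμ.1 (G.prof f)
  have := hμ.1 (G.prof g)
  have hopen : ∀ U : Set G.Play, IsOpen U → μ (G.prof f) U = μ (G.prof g) U := by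
    intro U hU
    rw [G.measure_open _ hU, G.measure_open _ hU]
    refine iSup_congr fun n => tsum_congr fun x => ?_
    rcases G.piece_eq U n (x.1, x.2.1) with h | ⟨p0, h⟩ <;> rw [h]
    · simp
    · exact hcyl _ _
  exact ext_of_generate_finite _ (BorelSpace.measurable_eq (α := G.Play)) isPiSystem_isOpen
    (fun U hU => hopen U hU) (by simp)

end Aux2

end PGame

namespace PGame

section Aux3

open Relation Filter Topology MeasureTheory

variable {N S A : Type*} (G : PGame N S A)

/-- Product of discrete topologies on selections. -/
noncomputable instance instTopSel : TopologicalSpace G.Sel :=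
  letI : ∀ s, TopologicalSpace {a : A // a ∈ G.act s} := fun _ => ⊥
  inferInstanceAs (TopologicalSpace (∀ s, {a : A // a ∈ G.act s}))

instance instCompactSel : CompactSpace G.Sel := by
  let : ∀ s, TopologicalSpace {a : A // a ∈ G.act s} := fun _ => ⊥
  exact inferInstanceAs (CompactSpace (∀ s, {a : A // a ∈ G.act s}))

instance instFirstSel [Countable S] : FirstCountableTopology G.Sel := by
  let : ∀ s, TopologicalSpace {a : A // a ∈ G.act s} := fun _ => ⊥
  have : ∀ s, DiscreteTopology {a : A // a ∈ G.act s} := fun _ => ⟨rfl⟩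
  exact inferInstanceAs (FirstCountableTopology (∀ s, {a : A // a ∈ G.act s}))

theorem nhds_agree (f : G.Sel) (F : Finset S) : ∀ᶠ g in 𝓝 f, ∀ s ∈ F, g s = f s := by
  let : ∀ s, TopologicalSpace {a : A // a ∈ G.act s} := fun _ => ⊥
  have : ∀ s, DiscreteTopology {a : A // a ∈ G.act s} := fun _ => ⟨rfl⟩
  rw [eventually_all_finset]
  intro s _
  have hc : Continuous (fun g : (∀ s, {a : A // a ∈ G.act s}) => g s) := continuous_apply s
  exact ((isOpen_discrete {f s}).preimage hc).mem_nhds rfl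

theorem exists_finset_of_nhds {f : G.Sel} {U : Set G.Sel} (hU : U ∈ 𝓝 f) :
    ∃ F : Finset S, ∀ g : G.Sel, (∀ s ∈ F, g s = f s) → g ∈ U := by
  let : ∀ s, TopologicalSpace {a : A // a ∈ G.act s} := fun _ => ⊥
  obtain ⟨V, hVU, hV, hf⟩ := mem_nhds_iff.1 hU
  have hV' : @IsOpen (∀ s, {a : A // a ∈ G.act s}) _ V := hV
  obtain ⟨I, w, hw, hsub⟩ := isOpen_pi_iff.1 hV' f hf
  refine ⟨I, fun g hg => hVU (hsub fun m hm => ?_)⟩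
  rw [hg m hm]
  exact (hw m hm).2

theorem exists_uniform_finset {φ : G.Sel → ℝ} (hφ : Continuous φ) {ε : ℝ} (hε : 0 < ε) :
    ∃ F : Finset S, ∀ f g : G.Sel, (∀ s ∈ F, f s = g s) → |φ f - φ g| ≤ ε := by
  have h : ∀ f : G.Sel, ∃ F : Finset S, ∀ g : G.Sel, (∀ s ∈ F, g s = f s) →
      |φ g - φ f| < ε / 2 := by
    intro f
    have : {g | |φ g - φ f| < ε / 2} ∈ 𝓝 f := by
      have := Metric.tendsto_nhds.1 (hφ.tendsto f) (ε / 2) (by positivity)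
      simp only [Real.dist_eq] at this
      exact this
    exact G.exists_finset_of_nhds this
  choose F hF using h
  obtain ⟨t, ht⟩ := isCompact_univ.elim_nhds_subcover
    (fun f : G.Sel => {g : G.Sel | ∀ s ∈ F f, g s = f s}) (fun f _ => G.nhds_agree f (F f))
  classical
  refine ⟨t.biUnion F, fun f g hfg => ?_⟩
  obtain ⟨x, hx, hfx⟩ : ∃ x ∈ t, ∀ s ∈ F x, f s = x s := by
    simpa using ht.2 (Set.mem_univ f)
  have h1 := hF x f hfx
  have h2 := hF x g fun s hs => by
    rw [← hfx s hs, hfg s (Finset.mem_biUnion.2 ⟨x, hx, hs⟩)]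
  rw [abs_lt] at h1 h2
  rw [abs_le]
  constructor <;> linarith

theorem continuous_rd (s : S) : Continuous (G.rd s) := by
  rw [continuous_iff_continuousAt]
  intro f U hU
  obtain ⟨F, hF⟩ := G.exists_finset_of_nhds hU
  refine mem_map.2 ?_
  filter_upwards [G.nhds_agree f F] with g hg
  refine hF _ fun z hz => ?_
  by_cases h : ReflTransGen G.step s z
  · rw [G.rd_below _ h, G.rd_below _ h, hg z hz]
  · rw [G.rd_not_below _ h, G.rd_not_below _ h]

variable {G} {μ : G.Profile → Measure G.Play}

theorem lsc_measure [Countable S] (hμ : G.IsInducedMeasure μ) {U : Set G.Play} (hU : IsOpen U) :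
    LowerSemicontinuous fun f : G.Sel => μ (G.prof f) U := by
  simp_rw [fun f : G.Sel => G.measure_open (μ (G.prof f)) hU]
  refine lowerSemicontinuous_iSup fun n => lowerSemicontinuous_tsum fun x => ?_
  refine Continuous.lowerSemicontinuous ?_
  rcases G.piece_eq U n (x.1, x.2.1) with h | ⟨p0, h⟩ <;> rw [h]
  · simpa using continuous_const
  · rw [continuous_iff_continuousAt]
    intro f
    classical
    have := G.nhds_agree f ((Finset.range (n + 1)).image fun m => (p0.1 m).1)
    refine tendsto_const_nhds.congr' ?_
    filter_upwards [this] with g hg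
    refine (measure_cyl_congr hμ _ _ _ _ fun m hm => ?_).symm
    exact hg _ (Finset.mem_image_of_mem _ (Finset.mem_range.2 hm))

theorem continuous_integral_sel [Countable S] (hμ : G.IsInducedMeasure μ) {φ : G.Play → ℝ}
    (hφ : Continuous φ) {C : ℝ} (hC : ∀ p, |φ p| ≤ C) :
    Continuous fun f : G.Sel => ∫ p, φ p ∂(μ (G.prof f)) := by
  rw [continuous_iff_continuousAt]
  intro f
  let P : G.Sel → ProbabilityMeasure G.Play := fun g => ⟨μ (G.prof g), hμ.1 _⟩
  have ht : Tendsto P (𝓝 f) (𝓝 (P f)) := by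
    refine tendsto_of_forall_isOpen_le_liminf' fun U hU => ?_
    exact lowerSemicontinuousAt_iff_le_liminf.1 (lsc_measure hμ hU f)
  have := ProbabilityMeasure.tendsto_iff_forall_integral_tendsto.1 ht
    (BoundedContinuousFunction.ofNormedAddCommGroup φ hφ C hC)
  exact this

variable {u : N → G.Play → ℝ} {E : G.Profile → S → N → ℝ}

theorem subgame_eq [Countable S] (hμ : G.IsInducedMeasure μ) (hE : G.IsSubgamePayoff μ u E)
    (σ : G.Profile) (f : G.Sel) (s : S) (i : N)
    (h : ∀ z, ReflTransGen G.step s z → (f z).1 = G.playFun σ z) :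
    E σ s i = (∫ p in G.through s, u i p ∂(μ (G.prof (G.rd s f)))) /
      (μ (G.prof (G.rd s f)) (G.through s)).toReal := by
  have := hμ.1 (G.prof (G.rd s f))
  rw [hE σ (G.prof (G.rd s f)) s i fun z hz => by
    rw [playFun_prof, G.rd_below f hz, h z hz]]
  rw [mul_div_assoc, div_self, mul_one]
  exact ENNReal.toReal_ne_zero.2
    ⟨measure_through_ne_zero hμ _ (G.rd_reach s f), measure_ne_top _ _⟩

theorem subgame_congr [Countable S] (hμ : G.IsInducedMeasure μ) (hE : G.IsSubgamePayoff μ u E)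
    (σ : G.Profile) (f : G.Sel) (s : S) (i : N)
    (h : ∀ z, ReflTransGen G.step s z → (f z).1 = G.playFun σ z) :
    E σ s i = E (G.prof f) s i := by
  rw [subgame_eq hμ hE σ f s i h, subgame_eq hμ hE (G.prof f) f s i fun _ _ => rfl]

theorem subgame_congr_reach [Countable S] (hμ : G.IsInducedMeasure μ)
    (hE : G.IsSubgamePayoff μ u E) (f g : G.Sel) (s : S) (i : N)
    (h : ∀ z, ReflTransGen (G.stepS f) s z → f z = g z) :
    E (G.prof f) s i = E (G.prof g) s i := by
  rw [subgame_eq hμ hE (G.prof f) f s i fun _ _ => rfl,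
    subgame_eq hμ hE (G.prof g) g s i fun _ _ => rfl]
  rw [measure_congr_reach hμ (G.rd s f) (G.rd s g)]
  intro z hz
  by_cases hb : ReflTransGen G.step s z
  · rw [G.rd_below _ hb, G.rd_below _ hb, h z (G.rd_reach_below f hz hb)]
  · rw [G.rd_not_below _ hb, G.rd_not_below _ hb]

theorem subgame_bound [Countable S] (hμ : G.IsInducedMeasure μ) (hE : G.IsSubgamePayoff μ u E)
    {i : N} {C : ℝ} (hC : ∀ p, |u i p| ≤ C) (f : G.Sel) (s : S) : |E (G.prof f) s i| ≤ C := by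
  have := hμ.1 (G.prof (G.rd s f))
  rw [subgame_eq hμ hE (G.prof f) f s i fun _ _ => rfl, abs_div]
  have h0 := ENNReal.toReal_pos (measure_through_ne_zero hμ _ (G.rd_reach s f))
    (measure_ne_top (μ (G.prof (G.rd s f))) (G.through s))
  rw [abs_of_pos h0, div_le_iff₀ h0]
  have := norm_setIntegral_le_of_norm_le_const (f := u i) (s := G.through s) (C := C)
    (measure_lt_top (μ (G.prof (G.rd s f))) _) fun p _ => hC p
  exact this

theorem continuous_subgame [Countable S] (hμ : G.IsInducedMeasure μ)
    (hE : G.IsSubgamePayoff μ u E) {i : N} {C : ℝ} (hC : ∀ p, |u i p| ≤ C)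
    (hu : Continuous (u i)) (s : S) : Continuous fun f : G.Sel => E (G.prof f) s i := by
  simp_rw [fun f : G.Sel => subgame_eq hμ hE (G.prof f) f s i fun _ _ => rfl]
  have hm : MeasurableSet (G.through s) := (G.isOpen_through s).measurableSet
  have hcl : IsClopen (G.through s) := ⟨G.isClosed_through s, G.isOpen_through s⟩
  have h1 : Continuous fun f : G.Sel => ∫ p in G.through s, u i p ∂(μ (G.prof f)) := by
    simp_rw [← integral_indicator hm]
    refine continuous_integral_sel hμ (C := C) (hu.indicator ?_) fun p => ?_
    · intro p hp
      rw [hcl.frontier_eq] at hp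
      exact absurd hp (Set.notMem_empty p)
    · by_cases hp : p ∈ G.through s
      · rw [Set.indicator_of_mem hp]; exact hC p
      · rw [Set.indicator_of_notMem hp, abs_zero]; exact (abs_nonneg _).trans (hC p)
  have h2 : Continuous fun f : G.Sel => (μ (G.prof f) (G.through s)).toReal := by
    have : ∀ f : G.Sel, (μ (G.prof f) (G.through s)).toReal =
        ∫ p, (G.through s).indicator (fun _ => (1 : ℝ)) p ∂(μ (G.prof f)) := by
      intro f
      rw [integral_indicator hm]
      simp [Measure.real]
    simp_rw [this]
    refine continuous_integral_sel hμ (C := 1) (continuous_const.indicator ?_) fun p => ?_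
    · intro p hp
      rw [hcl.frontier_eq] at hp
      exact absurd hp (Set.notMem_empty p)
    · by_cases hp : p ∈ G.through s <;> simp [hp]
  refine (h1.comp (G.continuous_rd s)).div (h2.comp (G.continuous_rd s)) fun f => ?_
  have := hμ.1 (G.prof (G.rd s f))
  exact ENNReal.toReal_ne_zero.2
    ⟨measure_through_ne_zero hμ _ (G.rd_reach s f), measure_ne_top _ _⟩

theorem subgame_step [Countable S] (hμ : G.IsInducedMeasure μ) (hE : G.IsSubgamePayoff μ u E)
    {i : N} {C : ℝ} (hC : ∀ p, |u i p| ≤ C) (hu : Continuous (u i)) (f : G.Sel) (s : S) :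
    HasSum (fun z => (G.q s (f s).1 z).toReal * E (G.prof f) z i) (E (G.prof f) s i) := by
  set t := G.rd s f with ht
  have := hμ.1 (G.prof t)
  have hts : t s = f s := G.rd_below f ReflTransGen.refl
  have hbel : ∀ z, ReflTransGen G.step s z → t z = f z := fun z hz => G.rd_below f hz
  have hreach := G.rd_reach s f
  have hM0 : (μ (G.prof t) (G.through s)).toReal ≠ 0 := ENNReal.toReal_ne_zero.2
    ⟨measure_through_ne_zero hμ _ hreach, measure_ne_top _ _⟩
  have hsucc : ∀ (p : G.Play) (z : S), z ∈ (G.q s (f s).1).support → ∀ n, (p.1 n).1 = z →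
      ∃ m, n = m + 1 ∧ (p.1 m).1 = s := by
    intro p z hz n hn
    cases n with
    | zero =>
      rw [p.2.1] at hn
      exact absurd (hn ▸ hz) (G.init_not_succ _ _ (f s).2)
    | succ m =>
      refine ⟨m, rfl, ?_⟩
      exact (G.unique_pred _ _ _ _ _ (p.2.2 m).1 (f s).2 (p.2.2 m).2 (hn ▸ hz)).1
  -- measures of the successors
  have hmz : ∀ z ∈ (G.q s (f s).1).support, μ (G.prof t) (G.through z) =
      μ (G.prof t) (G.through s) * G.q s (f s).1 z := by
    intro z hz
    obtain ⟨p, hp, n, hn⟩ := G.exists_play t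
      (hreach.tail (show G.stepS t s z by unfold stepS; rw [hts]; exact hz))
    obtain ⟨m, rfl, hm⟩ := hsucc p z hz n hn
    rw [← hn, measure_through hμ t p _ hp, Finset.prod_range_succ, ← measure_through hμ t p m hp,
      hp m, hm, hts]
  have hae : (G.through s : Set G.Play) =ᵐ[μ (G.prof t)]
      (⋃ z : (G.q s (f s).1).support, G.through z.1 : Set G.Play) := by
    filter_upwards [ae_follows hμ t] with p hp
    apply propext
    constructor
    · rintro ⟨n, hn⟩
      refine Set.mem_iUnion.2 ⟨⟨(p.1 (n + 1)).1, ?_⟩, n + 1, rfl⟩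
      have := (p.2.2 n).2
      rwa [hp n, hn, hts] at this
    · intro h
      obtain ⟨z, n, hn⟩ := Set.mem_iUnion.1 h
      obtain ⟨m, -, hm⟩ := hsucc p z.1 z.2 n hn
      exact ⟨m, hm⟩
  have hIntg : Integrable (u i) (μ (G.prof t)) := by
    refine Integrable.of_bound (hu.measurable.aestronglyMeasurable) C (ae_of_all _ hC)
  have hsum := hasSum_integral_iUnion (μ := μ (G.prof t)) (f := u i)
    (s := fun z : (G.q s (f s).1).support => G.through z.1)
    (fun z => (G.isOpen_through _).measurableSet) (by
      intro z z' hzz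
      rw [Function.onFun, Set.disjoint_left]
      rintro p ⟨n, hn⟩ ⟨n', hn'⟩
      obtain ⟨m, rfl, hm⟩ := hsucc p _ z.2 n hn
      obtain ⟨m', rfl, hm'⟩ := hsucc p _ z'.2 n' hn'
      obtain ⟨rfl, -⟩ := G.play_unique p p m m' (hm.trans hm'.symm)
      exact hzz (Subtype.ext (hn.symm.trans hn'))) hIntg.integrableOn
  rw [← setIntegral_congr_set hae] at hsum
  rw [hE (G.prof f) (G.prof t) s i fun z hz => by
    rw [playFun_prof, playFun_prof, hbel z hz]] at hsum
  have hterm : ∀ z : (G.q s (f s).1).support, ∫ p in G.through z.1, u i p ∂(μ (G.prof t)) =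
      ((G.q s (f s).1 z.1).toReal * E (G.prof f) z.1 i) *
        (μ (G.prof t) (G.through s)).toReal := by
    intro z
    rw [hE (G.prof f) (G.prof t) z.1 i fun w hw => by
      rw [playFun_prof, playFun_prof, hbel w (ReflTransGen.head ⟨_, (f s).2, z.2⟩ hw)],
      hmz z.1 z.2, ENNReal.toReal_mul]
    ring
  simp_rw [hterm] at hsum
  rw [hasSum_mul_right_iff hM0] at hsum
  refine (hasSum_subtype_iff_of_support_subset
    (f := fun z => (G.q s (f s).1 z).toReal * E (G.prof f) z i) ?_).1 hsum
  intro z hz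
  rw [Function.mem_support] at hz
  rw [PMF.mem_support_iff]
  intro h0
  apply hz
  simp [h0]

end Aux3

end PGame

namespace PGame

section Aux4

open Relation Filter Topology MeasureTheory

variable {N S A : Type*} (G : PGame N S A)

/-- Selections in `B`. -/
def SelIn (B : S → Set A) : Type _ := {f : G.Sel // ∀ s, (f s).1 ∈ B s}

open Classical in
/-- Player `i` follows `f`, the others follow `g`. -/
noncomputable def mix (i : N) (f g : G.Sel) : G.Sel := fun z => if G.ctrl z = i then f z else g z

theorem mix_mem {B : S → Set A} (i : N) (f g : G.SelIn B) (z : S) :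
    (G.mix i f.1 g.1 z).1 ∈ B z := by
  unfold mix
  split_ifs
  · exact f.2 z
  · exact g.2 z

theorem mix_congr {i : N} {f g f' g' : G.Sel} {z : S} (h1 : f z = f' z) (h2 : g z = g' z) :
    G.mix i f g z = G.mix i f' g' z := by
  unfold mix
  rw [h1, h2]

open Classical in
theorem playFun_comb (i : N) (t : G.Strat i) (σ : G.Profile) (z : S) :
    G.playFun (G.comb i t σ) z = if G.ctrl z = i then t.1 z else G.playFun σ z := by
  unfold playFun comb
  split_ifs with h
  · subst h
    exact congrArg (fun x : G.Strat (G.ctrl z) => x.1 z)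
      (Function.update_self (β := fun j => G.Strat j) (G.ctrl z) t σ)
  · exact congrArg (fun x : G.Strat (G.ctrl z) => x.1 z)
      (Function.update_of_ne (β := fun j => G.Strat j) h t σ)

open Classical in
/-- Projection of a function to the selections in `B`. -/
noncomputable def proj {B : S → Set A} (hB : ∀ s, B s ⊆ (G.act s : Set A)) (c : G.SelIn B)
    (h : S → A) : G.SelIn B :=
  ⟨fun z => if hz : h z ∈ B z then ⟨h z, hB z hz⟩ else c.1 z, fun z => by
    dsimp only
    split_ifs with hz
    · exact hz
    · exact c.2 z⟩

theorem proj_of_mem {B : S → Set A} (hB : ∀ s, B s ⊆ (G.act s : Set A)) (c : G.SelIn B)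
    (h : S → A) {z : S} (hz : h z ∈ B z) : ((G.proj hB c h).1 z).1 = h z := by
  simp [proj, hz]

theorem proj_self {B : S → Set A} (hB : ∀ s, B s ⊆ (G.act s : Set A)) (c : G.SelIn B)
    (f : G.SelIn B) : G.proj hB c (fun z => (f.1 z).1) = f := by
  apply Subtype.ext
  funext z
  exact Subtype.ext (G.proj_of_mem hB c _ (f.2 z))

variable {G} {μ : G.Profile → Measure G.Play} {u : N → G.Play → ℝ} {E : G.Profile → S → N → ℝ}

theorem rval_eq [Countable S] (hμ : G.IsInducedMeasure μ) (hE : G.IsSubgamePayoff μ u E)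
    {B : S → Set A} (hB : ∀ s, B s ⊆ (G.act s : Set A)) (c : G.SelIn B) (s : S) (i : N) :
    G.rval E B s i = ⨆ f : G.SelIn B, ⨅ g : G.SelIn B, E (G.prof (G.mix i f.1 g.1)) s i := by
  unfold rval
  refine Function.Surjective.iSup_congr (fun t => G.proj hB c t.1.1) ?_ ?_
  · intro f
    refine ⟨⟨⟨fun z => (f.1 z).1, fun z _ => (f.1 z).2⟩, fun z _ _ => f.2 z⟩, ?_⟩
    exact G.proj_self hB c f
  intro t
  symm
  refine Function.Surjective.iInf_congr (fun o => G.proj hB c (G.playFun o.1)) ?_ ?_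
  · intro f
    refine ⟨⟨G.prof f.1, fun z _ _ => f.2 z⟩, ?_⟩
    exact G.proj_self hB c f
  intro o
  let g : G.Sel := fun z => ⟨G.playFun (G.comb i t.1 o.1) z, G.playFun_mem _ z⟩
  rw [subgame_congr hμ hE (G.comb i t.1 o.1) g s i fun _ _ => rfl]
  refine subgame_congr_reach hμ hE _ _ s i fun z hz => ?_
  have hzB : ReflTransGen (G.stepIn B) s z := by
    refine ReflTransGen.mono (fun x y hxy => ?_) _ _ hz
    exact ⟨_, G.mix_mem i _ _ x, hxy⟩
  apply Subtype.ext
  change _ = G.playFun (G.comb i t.1 o.1) z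
  rw [playFun_comb]
  unfold mix
  split_ifs with h
  · exact G.proj_of_mem hB c _ (t.2 z hzB h)
  · exact G.proj_of_mem hB c _ (o.2 z hzB h)

/-- Abstract value. -/
noncomputable def val (E : G.Profile → S → N → ℝ) (B : S → Set A) (s : S) (i : N) : ℝ :=
  ⨆ f : G.SelIn B, ⨅ g : G.SelIn B, E (G.prof (G.mix i f.1 g.1)) s i

section Bounds

variable {B : S → Set A} {i : N} {C : ℝ}

theorem bddBelow_inner (hC : ∀ (f : G.Sel) s, |E (G.prof f) s i| ≤ C) (f : G.SelIn B) (s : S) :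
    BddBelow (Set.range fun g : G.SelIn B => E (G.prof (G.mix i f.1 g.1)) s i) := by
  refine ⟨-C, ?_⟩
  rintro _ ⟨g, rfl⟩
  exact (abs_le.1 (hC _ s)).1

theorem bddAbove_outer (hC : ∀ (f : G.Sel) s, |E (G.prof f) s i| ≤ C) (s : S) :
    BddAbove (Set.range fun f : G.SelIn B =>
      ⨅ g : G.SelIn B, E (G.prof (G.mix i f.1 g.1)) s i) := by
  refine ⟨C, ?_⟩
  rintro _ ⟨f, rfl⟩
  exact (ciInf_le (bddBelow_inner hC f s) f).trans (abs_le.1 (hC _ s)).2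

theorem le_val (hC : ∀ (f : G.Sel) s, |E (G.prof f) s i| ≤ C) (s : S) (f : G.SelIn B) {x : ℝ}
    (h : ∀ g : G.SelIn B, x ≤ E (G.prof (G.mix i f.1 g.1)) s i) : x ≤ val E B s i := by
  have : Nonempty (G.SelIn B) := ⟨f⟩
  exact (le_ciInf h).trans (le_ciSup (bddAbove_outer hC s) f)

theorem val_le (hC : ∀ (f : G.Sel) s, |E (G.prof f) s i| ≤ C) (s : S) (c : G.SelIn B) {x : ℝ}
    (h : ∀ f : G.SelIn B, ∃ g : G.SelIn B, E (G.prof (G.mix i f.1 g.1)) s i ≤ x) :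
    val E B s i ≤ x := by
  have : Nonempty (G.SelIn B) := ⟨c⟩
  refine ciSup_le fun f => ?_
  obtain ⟨g, hg⟩ := h f
  exact (ciInf_le (bddBelow_inner hC f s) g).trans hg

theorem exists_near_val (s : S) (c : G.SelIn B)
    (hC : ∀ (f : G.Sel) s, |E (G.prof f) s i| ≤ C) {ε : ℝ} (hε : 0 < ε) :
    ∃ f : G.SelIn B, ∀ g : G.SelIn B, val E B s i - ε ≤ E (G.prof (G.mix i f.1 g.1)) s i := by
  have : Nonempty (G.SelIn B) := ⟨c⟩
  obtain ⟨f, hf⟩ := exists_lt_of_lt_ciSup (show val E B s i - ε < val E B s i by linarith)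
  exact ⟨f, fun g => hf.le.trans (ciInf_le (bddBelow_inner hC f s) g)⟩

theorem exists_reply (s : S) (hC : ∀ (f : G.Sel) s, |E (G.prof f) s i| ≤ C) (f : G.SelIn B)
    {ε : ℝ} (hε : 0 < ε) :
    ∃ g : G.SelIn B, E (G.prof (G.mix i f.1 g.1)) s i ≤ val E B s i + ε := by
  have : Nonempty (G.SelIn B) := ⟨f⟩
  have h1 : (⨅ g : G.SelIn B, E (G.prof (G.mix i f.1 g.1)) s i) < val E B s i + ε := by
    have : _ ≤ val E B s i := le_ciSup (bddAbove_outer hC s) f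
    linarith
  obtain ⟨g, hg⟩ := exists_lt_of_ciInf_lt h1
  exact ⟨g, hg.le⟩

theorem abs_val_le (hC : ∀ (f : G.Sel) s, |E (G.prof f) s i| ≤ C) (s : S) (c : G.SelIn B) :
    |val E B s i| ≤ C := by
  rw [abs_le]
  exact ⟨le_val hC s c fun g => (abs_le.1 (hC _ s)).1,
    val_le hC s c fun f => ⟨c, (abs_le.1 (hC _ s)).2⟩⟩

end Bounds

/-- Gluing selections below the successors of `s`. -/
theorem exists_glue {B : S → Set A} {s : S} (a : A) (ha : a ∈ G.act s) (haB : a ∈ B s)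
    (c : G.SelIn B) (h : S → G.SelIn B) :
    ∃ f : G.SelIn B, (f.1 s).1 = a ∧ ∀ z ∈ (G.q s a).support, ∀ w, ReflTransGen G.step z w →
      f.1 w = (h z).1 w := by
  classical
  let P : S → S → Prop := fun w z => z ∈ (G.q s a).support ∧ ReflTransGen G.step z w
  let c' : G.Sel := Function.update c.1 s ⟨a, ha⟩
  have hc' : ∀ w, (c' w).1 ∈ B w := by
    intro w
    by_cases hw : w = s
    · subst hw
      have : c' w = ⟨a, ha⟩ := Function.update_self ..
      rw [this]; exact haB
    · have : c' w = c.1 w := Function.update_of_ne hw ..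
      rw [this]; exact c.2 w
  let f : G.Sel := fun w => if hw : ∃ z, P w z then (h hw.choose).1 w else c' w
  have hf : ∀ w, (f w).1 ∈ B w := by
    intro w
    by_cases hw : ∃ z, P w z
    · have : f w = (h hw.choose).1 w := dif_pos hw
      rw [this]; exact (h _).2 w
    · have : f w = c' w := dif_neg hw
      rw [this]; exact hc' w
  refine ⟨⟨f, hf⟩, ?_, ?_⟩
  · have hs : ¬ ∃ z, P s z := by
      rintro ⟨z, hz, hr⟩
      exact G.no_loop s (TransGen.head' ⟨a, ha, hz⟩ hr)
    have : f s = c' s := dif_neg hs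
    change (f s).1 = a
    rw [this]
    have : c' s = ⟨a, ha⟩ := Function.update_self ..
    rw [this]
  · intro z hz w hw
    have hex : ∃ z, P w z := ⟨z, hz, hw⟩
    have e : f w = (h hex.choose).1 w := dif_pos hex
    change f w = _
    rw [e, G.unique_branch ha hex.choose_spec.1 hz hex.choose_spec.2 hw]

theorem summable_q (s : S) (a : A) : HasSum (fun z => (G.q s a z).toReal) 1 := by
  have h := (G.q s a).tsum_coe
  have h1 : Summable fun z => (G.q s a z).toReal :=
    ENNReal.summable_toReal (by rw [h]; exact ENNReal.one_ne_top)
  have h2 : ∑' z, (G.q s a z).toReal = 1 := by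
    rw [← ENNReal.tsum_toReal_eq (fun z => (G.q s a).apply_ne_top z), h, ENNReal.toReal_one]
  exact h2 ▸ h1.hasSum

theorem summable_q_mul (s : S) (a : A) {φ : S → ℝ} {C : ℝ} (h : ∀ z, |φ z| ≤ C) :
    Summable fun z => (G.q s a z).toReal * φ z := by
  refine Summable.of_norm_bounded ((G.summable_q s a).summable.mul_right C) fun z => ?_
  rw [norm_mul, Real.norm_of_nonneg ENNReal.toReal_nonneg]
  exact mul_le_mul_of_nonneg_left (h z) ENNReal.toReal_nonneg

/-- The dynamic programming equation for the controlling player. -/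
theorem exists_optimal [Countable S] {B : S → Set A} (hB : ∀ s, B s ⊆ (G.act s : Set A))
    (hμ : G.IsInducedMeasure μ) (hE : G.IsSubgamePayoff μ u E) {C : ℝ} {i : N}
    (hu : Continuous (u i)) (hC : ∀ p, |u i p| ≤ C) (c : G.SelIn B)
    (s : S) (hs : G.ctrl s = i) :
    ∃ a ∈ B s, ∑' z, (G.q s a z).toReal * val E B z i = val E B s i := by
  have hb : ∀ (f : G.Sel) s, |E (G.prof f) s i| ≤ C := fun f s => subgame_bound hμ hE hC f s
  have hstep := fun f s => subgame_step hμ hE hC hu f s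
  have hmixs : ∀ f g : G.Sel, G.mix i f g s = f s := fun f g => if_pos hs
  have hsv : ∀ a, Summable fun z => (G.q s a z).toReal * val E B z i := fun a =>
    G.summable_q_mul s a fun z => abs_val_le hb z c
  have hdesc : ∀ (f g : G.Sel) z, (∀ w, ReflTransGen G.step z w → f w = g w) →
      E (G.prof f) z i = E (G.prof g) z i := fun f g z h =>
    subgame_congr_reach hμ hE f g z i fun w hw =>
      h w (ReflTransGen.mono (fun _ _ h => G.stepS_step h) _ _ hw)
  -- comparison of weighted sums
  have hcmp : ∀ (a : A) (φ ψ : S → ℝ) (ε : ℝ), (∀ z ∈ (G.q s a).support, φ z ≤ ψ z + ε) →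
      (Summable fun z => (G.q s a z).toReal * φ z) →
      (Summable fun z => (G.q s a z).toReal * ψ z) →
      ∑' z, (G.q s a z).toReal * φ z ≤ ∑' z, (G.q s a z).toReal * ψ z + ε := by
    intro a φ ψ ε h h1 h2
    have h3 := h2.hasSum.add ((G.summable_q s a).mul_right ε)
    rw [one_mul] at h3
    refine hasSum_le (fun z => ?_) h1.hasSum h3
    by_cases hz : z ∈ (G.q s a).support
    · have := mul_le_mul_of_nonneg_left (h z hz) (ENNReal.toReal_nonneg (a := G.q s a z))
      linarith
    · have : G.q s a z = 0 := by
        by_contra h0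
        exact hz ((PMF.mem_support_iff _ _).2 h0)
      simp [this]
  have hge : ∀ a ∈ B s, ∑' z, (G.q s a z).toReal * val E B z i ≤ val E B s i := by
    intro a ha
    refine le_of_forall_pos_le_add fun ε hε => ?_
    choose h hh using fun z => exists_near_val (E := E) z c hb hε
    obtain ⟨f, hfs, hf⟩ := G.exists_glue a (hB s ha) ha c h
    rw [← sub_le_iff_le_add]
    refine le_val hb s f fun g => ?_
    have hst := hstep (G.mix i f.1 g.1) s
    rw [hmixs, hfs] at hst
    rw [← hst.tsum_eq, sub_le_iff_le_add]
    refine hcmp a _ _ ε (fun z hz => ?_) (hsv a) hst.summable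
    rw [hdesc (G.mix i f.1 g.1) (G.mix i (h z).1 g.1) z fun w hw =>
      G.mix_congr (hf z hz w hw) rfl]
    have := hh z g
    linarith
  have hfin : (B s).Finite := (G.act s).finite_toSet.subset (hB s)
  obtain ⟨a, ha, hmax⟩ := Set.exists_max_image (B s)
    (fun a => ∑' z, (G.q s a z).toReal * val E B z i) hfin ⟨_, c.2 s⟩
  refine ⟨a, ha, le_antisymm (hge a ha) ?_⟩
  refine le_of_forall_pos_le_add fun ε hε => ?_
  refine val_le hb s c fun f => ?_
  choose h hh using fun z => exists_reply (E := E) z hb f hε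
  obtain ⟨g, -, hg⟩ := G.exists_glue (f.1 s).1 (f.1 s).2 (f.2 s) c h
  refine ⟨g, ?_⟩
  have hst := hstep (G.mix i f.1 g.1) s
  rw [hmixs] at hst
  rw [← hst.tsum_eq]
  refine (hcmp (f.1 s).1 _ (fun z => val E B z i) ε (fun z hz => ?_) hst.summable (hsv _)).trans
    (add_le_add_left (hmax _ (f.2 s)) ε)
  rw [hdesc (G.mix i f.1 g.1) (G.mix i f.1 (h z).1) z fun w hw =>
      G.mix_congr rfl (hg z hz w hw)]
  exact hh z

/-- Values are close when the action sets agree on a suitable finite set. -/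
theorem val_close {B B' : S → Set A} (c : G.SelIn B) (c' : G.SelIn B') {i : N} {s : S} {C ε : ℝ}
    (hb : ∀ (f : G.Sel) s, |E (G.prof f) s i| ≤ C) {F : Finset S}
    (hF : ∀ f g : G.Sel, (∀ z ∈ F, f z = g z) → |E (G.prof f) s i - E (G.prof g) s i| ≤ ε)
    (hBB : ∀ z ∈ F, B z = B' z) : val E B s i ≤ val E B' s i + ε := by
  classical
  have tr : ∀ {D D' : S → Set A}, G.SelIn D' → (∀ z ∈ F, D z = D' z) → ∀ f : G.SelIn D,
      ∃ f' : G.SelIn D', ∀ z ∈ F, f'.1 z = f.1 z := by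
    intro D D' d hD f
    refine ⟨⟨fun z => if z ∈ F then f.1 z else d.1 z, fun z => ?_⟩, fun z hz => if_pos hz⟩
    by_cases hz : z ∈ F
    · simp only [hz, if_true]
      rw [← hD z hz]; exact f.2 z
    · simp only [hz, if_false]
      exact d.2 z
  have : Nonempty (G.SelIn B) := ⟨c⟩
  refine ciSup_le fun f => ?_
  obtain ⟨f', hf'⟩ := tr c' hBB f
  rw [← sub_le_iff_le_add]
  refine le_val hb s f' fun g' => ?_
  obtain ⟨g, hg⟩ := tr c (fun z hz => (hBB z hz).symm) g'
  have h1 := ciInf_le (bddBelow_inner hb f s) g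
  have h2 := hF (G.mix i f.1 g.1) (G.mix i f'.1 g'.1) fun z hz =>
    G.mix_congr (hf' z hz).symm (hg z hz)
  have h3 := (abs_le.1 h2).2
  linarith

end Aux4

end PGame

/-- **Convergence of the values along the elimination procedure** (Lemma 4):
in a multi-player perfect-information game with probabilistic transitions,
countable state space, nonempty finite action sets, and bounded continuous payoff
functions, for every player `i` and every state `s ∈ S^∞` one has
`lim_{k→∞} v^k_i(s) = v^∞_i(s)`. -/
theorem elimination_values_tendsto
    {N S A : Type*} [Finite N] [Countable S]
    (hN : 2 ≤ Nat.card N)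
    (G : PGame N S A) (u : N → G.Play → ℝ)
    (hu_bdd : ∀ i : N, ∃ C : ℝ, ∀ p : G.Play, |u i p| ≤ C)
    (hu_cont : ∀ i : N, Continuous (u i))
    (μ : G.Profile → MeasureTheory.Measure G.Play)
    (hμ : G.IsInducedMeasure μ)
    (E : G.Profile → S → N → ℝ)
    (hE : G.IsSubgamePayoff μ u E) :
    ∀ (i : N), ∀ s ∈ G.Sinf E,
      Filter.Tendsto (fun k : ℕ => G.rval E (G.Ak E k) s i)
        Filter.atTop (nhds (G.rval E (G.Ainf E) s i)) := by
  intro i s _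
  have hsub : ∀ k s, G.Ak E (k + 1) s ⊆ G.Ak E k s := fun k s a ha => ha.1
  have hanti : ∀ s, Antitone fun k => G.Ak E k s := fun s =>
    antitone_nat_of_succ_le fun k => hsub k s
  have hleg : ∀ k s, G.Ak E k s ⊆ (G.act s : Set A) := fun k s => hanti s (Nat.zero_le k)
  -- nonemptiness of the action sets
  have hne : ∀ k, Nonempty (G.SelIn (G.Ak E k)) := by
    intro k
    induction k with
    | zero => exact ⟨⟨G.exists_sel.some, fun s => (G.exists_sel.some s).2⟩⟩
    | succ k ih =>
      obtain ⟨c⟩ := ih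
      have : ∀ s, ∃ a : {a : A // a ∈ G.act s}, a.1 ∈ G.Ak E (k + 1) s := by
        intro s
        obtain ⟨C, hC⟩ := hu_bdd (G.ctrl s)
        obtain ⟨a, ha, he⟩ := PGame.exists_optimal (hleg k) hμ hE (hu_cont (G.ctrl s)) hC c s rfl
        refine ⟨⟨a, hleg k s ha⟩, ha, ?_⟩
        change G.rvalQ E (G.Ak E k) s a (G.ctrl s) = G.rval E (G.Ak E k) s (G.ctrl s)
        unfold PGame.rvalQ
        simp_rw [PGame.rval_eq hμ hE (hleg k) c]
        exact he
      choose f hf using this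
      exact ⟨⟨f, hf⟩⟩
  -- stabilization
  have hstab : ∀ z, ∃ K, ∀ k ≥ K, G.Ak E k z = G.Ainf E z := by
    intro z
    have hfin : ∀ a : {a : A // a ∈ G.act z}, ∃ K, a.1 ∈ G.Ak E K z → a.1 ∈ G.Ainf E z := by
      intro a
      by_cases ha : a.1 ∈ G.Ainf E z
      · exact ⟨0, fun _ => ha⟩
      · obtain ⟨K, hK⟩ : ∃ K, a.1 ∉ G.Ak E K z := by
          simpa [PGame.Ainf] using ha
        exact ⟨K, fun h => absurd h hK⟩
    choose K hK using hfin
    refine ⟨Finset.univ.sup K, fun k hk => Set.Subset.antisymm (fun a ha => ?_)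
      (Set.iInter_subset _ k)⟩
    refine hK ⟨a, hleg k z ha⟩ (hanti z ?_ ha)
    exact (Finset.le_sup (f := K) (Finset.mem_univ _)).trans hk
  choose K hK using hstab
  have hlegInf : ∀ z, G.Ainf E z ⊆ (G.act z : Set A) := fun z => by
    rw [← hK z (K z) le_rfl]; exact hleg _ z
  obtain ⟨cI⟩ : Nonempty (G.SelIn (G.Ainf E)) := by
    refine ⟨⟨fun z => (hne (K z)).some.1 z, fun z => ?_⟩⟩
    have := (hne (K z)).some.2 z
    rw [hK z (K z) le_rfl] at this
    exact this
  obtain ⟨C, hC⟩ := hu_bdd i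
  have hb : ∀ (f : G.Sel) s, |E (G.prof f) s i| ≤ C := fun f s =>
    PGame.subgame_bound hμ hE hC f s
  rw [Metric.tendsto_atTop]
  intro ε hε
  obtain ⟨F, hF⟩ := G.exists_uniform_finset
    (PGame.continuous_subgame hμ hE hC (hu_cont i) s) (half_pos hε)
  refine ⟨F.sup K, fun k hk => ?_⟩
  have hag : ∀ z ∈ F, G.Ak E k z = G.Ainf E z := fun z hz =>
    hK z k ((Finset.le_sup hz).trans hk)
  obtain ⟨c⟩ := hne k
  have h1 := PGame.val_close c cI hb hF hag
  have h2 := PGame.val_close cI c hb hF fun z hz => (hag z hz).symm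
  rw [PGame.rval_eq hμ hE (hleg k) c, PGame.rval_eq hμ hE hlegInf cI]
  change dist (PGame.val E (G.Ak E k) s i) (PGame.val E (G.Ainf E) s i) < ε
  rw [Real.dist_eq, abs_lt]
  constructor <;> linarith
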